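/- arXiv:1610.00900 — 10 statements merged into one kernel-verified Lean document; each statement's English description precedes it below -/
import Mathlib

section
/- Let C be a self-dual Z_2R linear code in Z_2^α × R^β, let κ = dim_{Z_2}((C_b)_X), and let δ be the natural number defined by |{u·c : c ∈ C}| = 2^δ. Then α = 2κ (in particular α is even and n = α + 2β is even), |C| = 2^{κ+β}, and |C_b| = 2^{κ+β−δ}. -/
open Finset

namespace Z2R

abbrev Rng : Type := DualNumber (ZMod 2)
noncomputable instance : DecidableEq Rng := Classical.decEq _
def uu : Rng := DualNumber.eps
abbrev Amb (α β : ℕ) : Type := (Fin α → ZMod 2) × (Fin β → Rng)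
def smulR {α β : ℕ} (d : Rng) (x : Amb α β) : Amb α β :=
  (fun i => d.fst * x.1 i, fun j => d * x.2 j)
def IsCode {α β : ℕ} (C : Set (Amb α β)) : Prop :=
  (0 : Amb α β) ∈ C ∧ (∀ x ∈ C, ∀ y ∈ C, x + y ∈ C) ∧ ∀ (d : Rng), ∀ x ∈ C, smulR d x ∈ C
def inn {α β : ℕ} (v w : Amb α β) : Rng :=
  TrivSqZeroExt.inr (∑ i, v.1 i * w.1 i) + ∑ j, v.2 j * w.2 j
def dual {α β : ℕ} (C : Set (Amb α β)) : Set (Amb α β) :=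
  {w | ∀ v ∈ C, inn v w = 0}
def IsSelfDual {α β : ℕ} (C : Set (Amb α β)) : Prop :=
  IsCode C ∧ C = dual C
def wtH {n : ℕ} (v : Fin n → ZMod 2) : ℕ := (univ.filter fun i => v i ≠ 0).card
noncomputable def wtLr (r : Rng) : ℕ := if r = 0 then 0 else if r = uu then 2 else 1
noncomputable def wtL {α β : ℕ} (c : Amb α β) : ℕ := wtH c.1 + ∑ j, wtLr (c.2 j)
noncomputable def N {β : ℕ} (w : Fin β → Rng) : ℕ :=
  (univ.filter fun j => w j = 1 ∨ w j = 1 + uu).card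
noncomputable def Nu {β : ℕ} (w : Fin β → Rng) : ℕ :=
  (univ.filter fun j => w j = uu).card
noncomputable def Ns {β : ℕ} (w y : Fin β → Rng) : ℕ :=
  (univ.filter fun j => w j = y j ∧ (w j = 1 ∨ w j = 1 + uu)).card
noncomputable def Nd {β : ℕ} (w y : Fin β → Rng) : ℕ :=
  (univ.filter fun j => (w j = 1 ∧ y j = 1 + uu) ∨ (w j = 1 + uu ∧ y j = 1)).card
noncomputable def N11 {β : ℕ} (w y : Fin β → Rng) : ℕ :=
  (univ.filter fun j => (w j = 1 ∨ w j = 1 + uu) ∧ (y j = 1 ∨ y j = 1 + uu)).card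
def CX {α β : ℕ} (C : Set (Amb α β)) : Set (Fin α → ZMod 2) := Prod.fst '' C
def CY {α β : ℕ} (C : Set (Amb α β)) : Set (Fin β → Rng) := Prod.snd '' C
def Separable {α β : ℕ} (C : Set (Amb α β)) : Prop := C = (CX C) ×ˢ (CY C)
def Cb {α β : ℕ} (C : Set (Amb α β)) : Set (Amb α β) :=
  {c ∈ C | ∀ j, c.2 j = 0 ∨ c.2 j = uu}
def lincomb {α β k : ℕ} (g : Fin k → Amb α β) : Set (Amb α β) :=
  {z | ∃ a : Fin k → Rng, z = ∑ i, smulR (a i) (g i)}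
noncomputable def theta (r : Rng) : ZMod 4 :=
  if r = 0 then 0 else if r = 1 then 1 else if r = uu then 2 else 3

/-- A `Z_2R`-linear code, seen as a vector space over `Z_2`. -/
def IsCode.toSubmodule {α β : ℕ} {C : Set (Amb α β)} (h : IsCode C) :
    Submodule (ZMod 2) (Amb α β) where
  carrier := C
  zero_mem' := h.1
  add_mem' := fun hx hy => h.2.1 _ hx _ hy
  smul_mem' := fun c x hx => by
    have hcx : smulR (TrivSqZeroExt.inl c) x = c • x := by
      refine Prod.ext (funext fun i => ?_) (funext fun j => ?_)
      · simp [smulR]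
      · exact TrivSqZeroExt.inl_mul_eq_smul c (x.2 j)
    rw [← hcx]
    exact h.2.2 _ x hx

/-- Coordinatewise `snd` of the inner product: the `Z_2`-valued form with the same duality. -/
def form (α β : ℕ) : LinearMap.BilinForm (ZMod 2) (Amb α β) :=
  LinearMap.mk₂ (ZMod 2)
    (fun v w => (∑ i, v.1 i * w.1 i) +
      ∑ j, ((v.2 j).fst * (w.2 j).snd + (v.2 j).snd * (w.2 j).fst))
    (fun a b c => by
      simp only [Prod.fst_add, Prod.snd_add, Pi.add_apply, TrivSqZeroExt.fst_add,
        TrivSqZeroExt.snd_add, add_mul, Finset.sum_add_distrib]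
      ring)
    (fun r a b => by
      simp only [Prod.smul_fst, Prod.smul_snd, Pi.smul_apply, TrivSqZeroExt.fst_smul,
        TrivSqZeroExt.snd_smul, smul_eq_mul, mul_add, Finset.mul_sum, mul_assoc])
    (fun a b c => by
      simp only [Prod.fst_add, Prod.snd_add, Pi.add_apply, TrivSqZeroExt.fst_add,
        TrivSqZeroExt.snd_add, mul_add, Finset.sum_add_distrib]
      ring)
    (fun r a b => by
      simp only [Prod.smul_fst, Prod.smul_snd, Pi.smul_apply, TrivSqZeroExt.fst_smul,
        TrivSqZeroExt.snd_smul, smul_eq_mul, mul_add, Finset.mul_sum, mul_left_comm])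

theorem form_apply {α β : ℕ} (v w : Amb α β) :
    form α β v w = (∑ i, v.1 i * w.1 i) +
      ∑ j, ((v.2 j).fst * (w.2 j).snd + (v.2 j).snd * (w.2 j).fst) := rfl

theorem fst_inn {α β : ℕ} (v w : Amb α β) : (inn v w).fst = ∑ j, (v.2 j).fst * (w.2 j).fst := by
  simp [inn, TrivSqZeroExt.fst_sum]

theorem snd_inn {α β : ℕ} (v w : Amb α β) : (inn v w).snd = form α β v w := by
  simp [inn, form_apply, TrivSqZeroExt.snd_sum, mul_comm]

theorem form_smulR_uu {α β : ℕ} (v w : Amb α β) :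
    form α β (smulR uu v) w = (inn v w).fst := by
  simp [form_apply, fst_inn, smulR, uu]

theorem form_comm {α β : ℕ} (v w : Amb α β) : form α β v w = form α β w v := by
  simp only [form_apply]
  congr 1
  · exact Finset.sum_congr rfl fun i _ => mul_comm _ _
  · exact Finset.sum_congr rfl fun j _ => by ring

theorem form_isRefl (α β : ℕ) : (form α β).IsRefl := fun v w h => by
  rw [form_comm, h]

theorem form_nondegenerate (α β : ℕ) : (form α β).Nondegenerate := by
  refine (LinearMap.IsRefl.nondegenerate_iff_separatingLeft (form_isRefl α β)).2 fun v hv => ?_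
  refine Prod.ext (funext fun i => ?_) (funext fun j => TrivSqZeroExt.ext ?_ ?_)
  · simpa [form_apply, Pi.single_apply] using hv (Pi.single i 1, 0)
  · simpa [form_apply, Pi.single_apply, apply_ite TrivSqZeroExt.fst, apply_ite TrivSqZeroExt.snd,
      uu] using hv (0, Pi.single j uu)
  · simpa [form_apply, Pi.single_apply, apply_ite TrivSqZeroExt.fst, apply_ite TrivSqZeroExt.snd]
      using hv (0, Pi.single j 1)

theorem finrank_rng : Module.finrank (ZMod 2) Rng = 2 := by
  change Module.finrank (ZMod 2) (ZMod 2 × ZMod 2) = 2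
  simp

instance : Module.Finite (ZMod 2) Rng :=
  inferInstanceAs (Module.Finite (ZMod 2) (ZMod 2 × ZMod 2))

theorem finrank_amb (α β : ℕ) : Module.finrank (ZMod 2) (Amb α β) = α + 2 * β := by
  rw [Module.finrank_prod, Module.finrank_pi, Module.finrank_pi_fintype]
  simp [finrank_rng, mul_comm]

/-- The dual of a code is its orthogonal complement for the `Z_2`-valued form. -/
theorem mem_dual_iff_forall_form {α β : ℕ} {C : Set (Amb α β)} (h : IsCode C) (w : Amb α β) :
    w ∈ dual C ↔ ∀ v ∈ C, form α β v w = 0 := by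
  refine ⟨fun hw v hv => ?_, fun hw v hv => TrivSqZeroExt.ext ?_ ?_⟩
  · rw [← snd_inn, hw v hv, TrivSqZeroExt.snd_zero]
  · rw [← form_smulR_uu, hw _ (h.2.2 uu v hv), TrivSqZeroExt.fst_zero]
  · rw [snd_inn, hw v hv, TrivSqZeroExt.snd_zero]

/-- Rank-nullity for a linear map restricted to a subspace. -/
theorem finrank_map_add_finrank_inf_ker {K V W : Type*} [Field K] [AddCommGroup V] [Module K V]
    [AddCommGroup W] [Module K W] [FiniteDimensional K V] (f : V →ₗ[K] W) (S : Submodule K V) :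
    Module.finrank K (S.map f) + Module.finrank K (S ⊓ LinearMap.ker f : Submodule K V) =
      Module.finrank K S := by
  have h := (f.domRestrict S).finrank_range_add_finrank_ker
  rw [LinearMap.range_domRestrict, LinearMap.ker_domRestrict] at h
  rw [← h, ← Submodule.map_comap_subtype, Submodule.finrank_map_subtype_eq]

/-- Reduction modulo `u` of the `R`-part. -/
def residue (α β : ℕ) : Amb α β →ₗ[ZMod 2] (Fin β → ZMod 2) where
  toFun x j := (x.2 j).fst
  map_add' _ _ := rfl
  map_smul' _ _ := rfl

/-- The embedding `z ↦ (0 | u z)`. -/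
def uEmb (α β : ℕ) : (Fin β → ZMod 2) →ₗ[ZMod 2] Amb α β where
  toFun z := (0, fun j => TrivSqZeroExt.inr (z j))
  map_add' _ _ := Prod.ext (by simp) (funext fun _ => TrivSqZeroExt.inr_add _ _ _)
  map_smul' c z := Prod.ext (by simp) (funext fun j => TrivSqZeroExt.inr_smul (ZMod 2) c (z j))

theorem residue_apply {α β : ℕ} (x : Amb α β) (j : Fin β) : residue α β x j = (x.2 j).fst := rfl

theorem uEmb_apply {α β : ℕ} (z : Fin β → ZMod 2) :
    uEmb α β z = (0, fun j => TrivSqZeroExt.inr (z j)) := rfl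

theorem uEmb_injective (α β : ℕ) : Function.Injective (uEmb α β) := fun _ _ h =>
  funext fun j => TrivSqZeroExt.inr_injective (congrFun (congrArg Prod.snd h) j)

theorem smulR_uu {α β : ℕ} (x : Amb α β) : smulR uu x = uEmb α β (residue α β x) := by
  refine Prod.ext (funext fun i => ?_) (funext fun j => TrivSqZeroExt.ext ?_ ?_) <;>
    simp [smulR, uu, uEmb_apply, residue_apply]

theorem form_uEmb {α β : ℕ} (v : Amb α β) (z : Fin β → ZMod 2) :
    form α β v (uEmb α β z) = residue α β v ⬝ᵥ z := by
  simp [form_apply, uEmb_apply, residue_apply, dotProduct]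

theorem dotProductBilin_isRefl (β : ℕ) :
    (dotProductBilin (ZMod 2) (ZMod 2) :
      LinearMap.BilinForm (ZMod 2) (Fin β → ZMod 2)).IsRefl := fun v w h => by
  rw [← h]
  exact dotProduct_comm w v

theorem dotProductBilin_nondegenerate (β : ℕ) :
    (dotProductBilin (ZMod 2) (ZMod 2) :
      LinearMap.BilinForm (ZMod 2) (Fin β → ZMod 2)).Nondegenerate := by
  exact (LinearMap.IsRefl.nondegenerate_iff_separatingLeft (dotProductBilin_isRefl β)).2
    fun v hv => dotProduct_eq_zero v hv

theorem IsSelfDual.mem_iff {α β : ℕ} {C : Set (Amb α β)} (hC : IsSelfDual C) (w : Amb α β) :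
    w ∈ C ↔ ∀ v ∈ C, form α β v w = 0 := by
  rw [← mem_dual_iff_forall_form hC.1, ← hC.2]

theorem coe_toSubmodule_inf_ker {α β : ℕ} {C : Set (Amb α β)} (h : IsCode C) :
    ((h.toSubmodule ⊓ LinearMap.ker (residue α β) : Submodule (ZMod 2) (Amb α β)) :
      Set (Amb α β)) = Cb C := by
  ext x
  refine and_congr Iff.rfl ?_
  simp only [SetLike.mem_coe, LinearMap.mem_ker, funext_iff]
  refine forall_congr' fun j => ⟨fun hj => ?_, ?_⟩
  · change (x.2 j).fst = 0 at hj
    rcases (by decide : ∀ a : ZMod 2, a = 0 ∨ a = 1) (x.2 j).snd with h0 | h1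
    · exact Or.inl (TrivSqZeroExt.ext hj h0)
    · exact Or.inr (TrivSqZeroExt.ext hj h1)
  · rintro (hj | hj) <;> simp [residue_apply, hj, uu]


-- STATEMENT 0
theorem stmt0 {α β : ℕ} (C : Set (Amb α β)) (hC : IsSelfDual C) (κ δ : ℕ)
    (hκ : κ = Module.finrank (ZMod 2) (Submodule.span (ZMod 2) (Prod.fst '' Cb C)))
    (hδ : Nat.card ((fun c => smulR uu c) '' C) = 2 ^ δ) :
    α = 2 * κ ∧ Even α ∧ Even (α + 2 * β) ∧
      Nat.card C = 2 ^ (κ + β) ∧ Nat.card (Cb C) = 2 ^ (κ + β - δ) := by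
  set S := hC.1.toSubmodule
  set D := S.map (residue α β)
  set B := S ⊓ LinearMap.ker (residue α β)
  have hB : (B : Set (Amb α β)) = Cb C := coe_toSubmodule_inf_ker hC.1
  have hS : (form α β).orthogonal S = S := by
    ext w
    exact (hC.mem_iff w).symm
  have hdimS := LinearMap.BilinForm.finrank_orthogonal (form_nondegenerate α β) S
  have hle := S.finrank_le
  rw [hS, finrank_amb] at hdimS
  rw [finrank_amb] at hle
  have hdimD := LinearMap.BilinForm.finrank_orthogonal (dotProductBilin_nondegenerate β) D
  have hDle := D.finrank_le
  rw [Module.finrank_fin_fun] at hdimD hDle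
  have hker : B ⊓ LinearMap.ker (LinearMap.fst (ZMod 2) _ _) =
      (LinearMap.BilinForm.orthogonal (dotProductBilin (ZMod 2) (ZMod 2)) D).map (uEmb α β) := by
    have key (z : Fin β → ZMod 2) : uEmb α β z ∈ S ↔
        z ∈ LinearMap.BilinForm.orthogonal (dotProductBilin (ZMod 2) (ZMod 2)) D := by
      refine (hC.mem_iff _).trans ?_
      simp only [form_uEmb]
      exact (Set.forall_mem_image (p := fun y => y ⬝ᵥ z = 0)).symm
    ext x
    constructor
    · rintro ⟨⟨hxS, hx⟩, hx1⟩
      have hxe : uEmb α β (fun j => (x.2 j).snd) = x :=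
        Prod.ext (Eq.symm hx1)
          (funext fun j => TrivSqZeroExt.ext (congrFun hx j).symm rfl)
      exact ⟨_, (key _).1 (hxe.symm ▸ hxS), hxe⟩
    · rintro ⟨z, hz, rfl⟩
      exact ⟨⟨(key z).2 hz, rfl⟩, rfl⟩
  have hS_rank : Module.finrank (ZMod 2) D + Module.finrank (ZMod 2) B =
      Module.finrank (ZMod 2) S :=
    finrank_map_add_finrank_inf_ker (residue α β) S
  have hB_rank := finrank_map_add_finrank_inf_ker (LinearMap.fst (ZMod 2) _ _) B
  rw [hker, ← (Submodule.equivMapOfInjective _ (uEmb_injective α β) _).finrank_eq] at hB_rank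
  have hκ' : κ = Module.finrank (ZMod 2) (B.map (LinearMap.fst (ZMod 2) _ _)) := by
    rw [hκ, ← hB]
    rw [← Submodule.span_eq (B.map (LinearMap.fst (ZMod 2) _ _)), Submodule.map_coe]
    rfl
  have hδ' : δ = Module.finrank (ZMod 2) D := by
    have himg : (fun c => smulR uu c) '' C = uEmb α β '' (D : Set (Fin β → ZMod 2)) := by
      simp only [smulR_uu]
      exact (Set.image_image _ _ _).symm
    rw [himg, Nat.card_image_of_injective (uEmb_injective α β)] at hδ
    have hD := Module.natCard_eq_pow_finrank (K := ZMod 2) (V := D)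
    rw [Nat.card_zmod] at hD
    exact Nat.pow_right_injective le_rfl (hδ.symm.trans hD)
  have hcardS : Nat.card C = 2 ^ Module.finrank (ZMod 2) S := by
    have h := Module.natCard_eq_pow_finrank (K := ZMod 2) (V := S)
    rwa [Nat.card_zmod] at h
  have hcardB : Nat.card (Cb C) = 2 ^ Module.finrank (ZMod 2) B := by
    rw [← hB]
    simpa using Module.natCard_eq_pow_finrank (K := ZMod 2) (V := B)
  have hα : α = 2 * κ := by omega
  refine ⟨hα, ⟨κ, by omega⟩, ⟨κ + β, by omega⟩, ?_, ?_⟩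
  · rw [hcardS]
    congr 1
    omega
  · rw [hcardB]
    congr 1
    omega

end Z2R
end

section
/- Let C be a self-dual Z_2R linear code in Z_2^α × R^β and let (v | w) ∈ C. Then wt_H(v) is even and N(w) is even. Moreover, the vectors (1,…,1 | 0,…,0), (0,…,0 | u,…,u) and (1,…,1 | u,…,u) all belong to C. -/
open Finset

namespace Z2R

theorem zmod_two_mul_self (x : ZMod 2) : x * x = x := by
  revert x; decide

theorem natCast_card_filter_ne_zero {n : ℕ} (f : Fin n → ZMod 2) :
    ((univ.filter fun i => f i ≠ 0).card : ZMod 2) = ∑ i, f i := by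
  rw [card_filter, Nat.cast_sum]
  refine sum_congr rfl fun i _ => ?_
  generalize f i = x
  revert x; decide

theorem eq_one_or_eq_one_add_uu_iff (r : Rng) : (r = 1 ∨ r = 1 + uu) ↔ r.fst ≠ 0 := by
  have h : ∀ a b : ZMod 2, ((a = 1 ∧ b = 0) ∨ (a = 1 ∧ b = 1)) ↔ a ≠ 0 := by decide
  simp only [TrivSqZeroExt.ext_iff, uu, DualNumber.eps, TrivSqZeroExt.fst_one,
    TrivSqZeroExt.snd_one, TrivSqZeroExt.fst_add, TrivSqZeroExt.snd_add, TrivSqZeroExt.fst_inr,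
    TrivSqZeroExt.snd_inr, add_zero, zero_add]
  exact h r.fst r.snd

theorem natCast_wtH {n : ℕ} (v : Fin n → ZMod 2) : (wtH v : ZMod 2) = ∑ i, v i :=
  natCast_card_filter_ne_zero v

theorem natCast_N {n : ℕ} (w : Fin n → Rng) : (N w : ZMod 2) = ∑ j, (w j).fst := by
  rw [← natCast_card_filter_ne_zero, N]
  simp_rw [eq_one_or_eq_one_add_uu_iff]

theorem snd_inn_s1 {α β : ℕ} (v w : Amb α β) :
    (inn v w).snd = ∑ i, v.1 i * w.1 i +
      ∑ j, ((v.2 j).fst * (w.2 j).snd + (v.2 j).snd * (w.2 j).fst) := by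
  simp [inn, TrivSqZeroExt.snd_sum, mul_comm]

theorem inn_self {α β : ℕ} (c : Amb α β) :
    (inn c c).fst = N c.2 ∧ (inn c c).snd = wtH c.1 := by
  rw [fst_inn, snd_inn_s1, natCast_N, natCast_wtH]
  simp [zmod_two_mul_self, mul_comm, CharTwo.add_self_eq_zero]

theorem even_of_mem {α β : ℕ} {C : Set (Amb α β)} (hC : IsSelfDual C) {c : Amb α β}
    (hc : c ∈ C) : Even (wtH c.1) ∧ Even (N c.2) := by
  have h : inn c c = 0 := (hC.2 ▸ hc : c ∈ dual C) c hc
  obtain ⟨hN, hw⟩ := inn_self c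
  rw [h] at hN hw
  exact ⟨(ZMod.natCast_eq_zero_iff_even).1 hw.symm, (ZMod.natCast_eq_zero_iff_even).1 hN.symm⟩

theorem const_mem {α β : ℕ} {C : Set (Amb α β)} (hC : IsSelfDual C) (a b : ZMod 2) :
    ((fun _ => a, fun _ => TrivSqZeroExt.inr b) : Amb α β) ∈ C := by
  rw [hC.2]
  intro c hc
  obtain ⟨hw, hN⟩ := even_of_mem hC hc
  rw [← ZMod.natCast_eq_zero_iff_even] at hw hN
  rw [natCast_wtH] at hw
  rw [natCast_N] at hN
  ext
  · simp [fst_inn]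
  · simp [snd_inn_s1, ← sum_mul, hw, hN]

-- STATEMENT 1
theorem stmt1 {α β : ℕ} (C : Set (Amb α β)) (hC : IsSelfDual C) :
    (∀ c ∈ C, Even (wtH c.1) ∧ Even (N c.2)) ∧
      ((fun _ => 1, fun _ => 0) : Amb α β) ∈ C ∧
      ((fun _ => 0, fun _ => uu) : Amb α β) ∈ C ∧
      ((fun _ => 1, fun _ => uu) : Amb α β) ∈ C := by
  refine ⟨fun c hc => even_of_mem hC hc, ?_, const_mem hC 0 1, const_mem hC 1 1⟩
  simpa using const_mem hC 1 0

end Z2R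
end

section
/- Let C be a self-dual Z_2R linear code in Z_2^α × R^β and let (v | w) and (x | y) be two codewords of C. Then N_s(w,y) ≡ N_d(w,y) (mod 2), and N_{1,1}(w,y) is even. -/
open Finset

namespace Z2R

theorem uu_ne_zero : uu ≠ 0 := fun h =>
  one_ne_zero (α := ZMod 2) (congrArg TrivSqZeroExt.snd h)

theorem one_or_one_add_uu_iff (r : Rng) : (r = 1 ∨ r = 1 + uu) ↔ r.fst = 1 := by
  have hcases : ∀ a : ZMod 2, a = 0 ∨ a = 1 := by decide
  constructor
  · rintro (rfl | rfl) <;> simp [uu]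
  · intro h
    rcases hcases r.snd with hs | hs
    · exact Or.inl (TrivSqZeroExt.ext (by simp [h]) (by simp [hs]))
    · exact Or.inr (TrivSqZeroExt.ext (by simp [h, uu]) (by simp [hs, uu]))

theorem N11_eq_Ns_add_Nd {β : ℕ} (w y : Fin β → Rng) : N11 w y = Ns w y + Nd w y := by
  have hne : (1 : Rng) ≠ 1 + uu := fun h => uu_ne_zero (by simpa using h.symm)
  unfold N11 Ns Nd
  rw [← card_union_of_disjoint, ← filter_or]
  · congr 1
    ext j
    simp only [mem_filter, mem_univ, true_and]
    grind
  · rw [disjoint_filter]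
    grind

theorem natCast_N11 {β : ℕ} (w y : Fin β → Rng) :
    (N11 w y : ZMod 2) = ∑ j, (w j).fst * (y j).fst := by
  have hmul : ∀ a b : ZMod 2, (if a = 1 ∧ b = 1 then (1 : ZMod 2) else 0) = a * b := by decide
  simp only [N11, one_or_one_add_uu_iff, natCast_card_filter, hmul]

-- STATEMENT 4
theorem stmt4 {α β : ℕ} (C : Set (Amb α β)) (hC : IsSelfDual C) :
    ∀ c ∈ C, ∀ d ∈ C, Ns c.2 d.2 % 2 = Nd c.2 d.2 % 2 ∧ Even (N11 c.2 d.2) := by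
  intro c hc d hd
  have hinn : inn c d = 0 := (hC.2 ▸ hd : d ∈ dual C) c hc
  have heven : Even (N11 c.2 d.2) := by
    rw [← ZMod.natCast_eq_zero_iff_even, natCast_N11, ← fst_inn, hinn, TrivSqZeroExt.fst_zero]
  refine ⟨?_, heven⟩
  rw [N11_eq_Ns_add_Nd, Nat.even_iff] at heven
  omega

end Z2R
end

section
/- Let C be a self-dual Z_2R linear code in Z_2^α × R^β. If every vector x ∈ C_X has Hamming weight wt_H(x) divisible by 4, then C is separable. -/
open Finset

namespace Z2R

theorem wtH_eq_sum_val {n : ℕ} (v : Fin n → ZMod 2) : wtH v = ∑ i, (v i).val := by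
  rw [wtH, Finset.card_filter]
  refine Finset.sum_congr rfl fun i _ => ?_
  generalize v i = a
  revert a
  decide

theorem wtH_add_wtH {n : ℕ} (v w : Fin n → ZMod 2) :
    wtH v + wtH w = wtH (v + w) + 2 * ∑ i, (v i * w i).val := by
  simp only [wtH_eq_sum_val, Finset.mul_sum, ← Finset.sum_add_distrib, Pi.add_apply]
  refine Finset.sum_congr rfl fun i _ => ?_
  generalize v i = a
  generalize w i = b
  revert a b
  decide

/-- Binary vectors whose weights and the weight of whose sum are divisible by four are
orthogonal. -/
theorem sum_mul_eq_zero_of_four_dvd_wtH {n : ℕ} {v w : Fin n → ZMod 2} (hv : 4 ∣ wtH v)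
    (hw : 4 ∣ wtH w) (hvw : 4 ∣ wtH (v + w)) : ∑ i, v i * w i = 0 := by
  have key := wtH_add_wtH v w
  have h2 : 2 ∣ ∑ i, (v i * w i).val := by omega
  simpa only [Nat.cast_sum, ZMod.natCast_val, ZMod.cast_id', id_eq] using
    (ZMod.natCast_eq_zero_iff _ 2).2 h2

-- STATEMENT 6
theorem stmt6 {α β : ℕ} (C : Set (Amb α β)) (hC : IsSelfDual C)
    (h : ∀ x ∈ CX C, 4 ∣ wtH x) : Separable C := by
  obtain ⟨⟨-, hadd, -⟩, hdual⟩ := hC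
  have hleft : ∀ x ∈ C, ((x.1, 0) : Amb α β) ∈ C := by
    intro x hx
    rw [hdual]
    intro v hv
    have horth : ∑ i, v.1 i * x.1 i = 0 :=
      sum_mul_eq_zero_of_four_dvd_wtH (h _ ⟨v, hv, rfl⟩) (h _ ⟨x, hx, rfl⟩)
        (h _ ⟨v + x, hadd v hv x hx, rfl⟩)
    simp [inn, horth]
  apply Set.Subset.antisymm
  · exact fun x hx => ⟨⟨x, hx, rfl⟩, ⟨x, hx, rfl⟩⟩
  · rintro ⟨a, b⟩ ⟨⟨x, hx, hxa⟩, ⟨y, hy, hyb⟩⟩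
    dsimp only at hxa hyb
    subst hxa hyb
    have hsum := hadd _ (hleft x hx) _ (hadd _ (hleft y hy) y hy)
    have hyy : y.1 + y.1 = 0 := funext fun i => CharTwo.add_self_eq_zero (y.1 i)
    convert hsum using 1
    ext1 <;> simp [hyy]

end Z2R
end

section
/- Let C be a self-dual Z_2R linear code in Z_2^α × R^β. If u·c = 0 for every c ∈ C (equivalently, no codeword of C has a coordinate in its R-part equal to a unit 1 or 1+u), then C is separable. -/
open Finset

namespace Z2R

theorem fst_eq_zero_of_smulR_uu {α β : ℕ} {c : Amb α β} (hc : smulR uu c = 0) (j : Fin β) :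
    (c.2 j).fst = 0 := by
  have hj : uu * c.2 j = 0 := congrFun (congrArg Prod.snd hc) j
  simpa [uu] using congrArg TrivSqZeroExt.snd hj

theorem sum_mul_eq_zero_of_fst_eq_zero {β : ℕ} {v w : Fin β → Rng}
    (hv : ∀ j, (v j).fst = 0) (hw : ∀ j, (w j).fst = 0) : ∑ j, v j * w j = 0 :=
  Finset.sum_eq_zero fun j _ => by ext <;> simp [hv j, hw j]

-- STATEMENT 7
theorem stmt7 {α β : ℕ} (C : Set (Amb α β)) (hC : IsSelfDual C)
    (h : ∀ c ∈ C, smulR uu c = 0) : Separable C := by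
  have hfst : ∀ c ∈ C, ∀ j, (c.2 j).fst = 0 := fun c hc => fst_eq_zero_of_smulR_uu (h c hc)
  refine Set.Subset.antisymm
    (fun x hx => ⟨Set.mem_image_of_mem _ hx, Set.mem_image_of_mem _ hx⟩) ?_
  rintro ⟨_, _⟩ ⟨⟨x, hx, rfl⟩, ⟨y, hy, rfl⟩⟩
  rw [hC.2]
  intro v hv
  have hvx : inn v x = 0 := (hC.2.subset hx) v hv
  simp only [inn, sum_mul_eq_zero_of_fst_eq_zero (hfst v hv) (hfst x hx)] at hvx
  simpa only [inn, sum_mul_eq_zero_of_fst_eq_zero (hfst v hv) (hfst y hy)] using hvx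

end Z2R
end

section
/- Let C be a self-dual Z_2R linear code in Z_2^α × R^β with α > 0 and β > 0. If C is of Type II, i.e. every codeword of C has Lee weight divisible by 4, then α ≡ 0 (mod 4) and β ≡ 0 (mod 2); in particular α ≥ 4 and β ≥ 2. -/
open Finset

namespace Z2R

/-- The coordinate sums of a self-orthogonal vector vanish modulo 2. -/
theorem sum_eq_zero_of_inn_self {α β : ℕ} {v : Amb α β} (h : inn v v = 0) :
    ∑ i, v.1 i = 0 ∧ ∑ j, (v.2 j).fst = 0 := by
  have hsq : ∀ a : ZMod 2, a * a = a := by decide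
  have hadd : ∀ a b : ZMod 2, a * b + b * a = 0 := by decide
  have hfst := congrArg TrivSqZeroExt.fst h
  have hsnd := congrArg TrivSqZeroExt.snd h
  simp only [inn, TrivSqZeroExt.fst_add, TrivSqZeroExt.fst_inr, TrivSqZeroExt.fst_sum,
    TrivSqZeroExt.fst_mul, TrivSqZeroExt.fst_zero, zero_add, hsq] at hfst
  simp only [inn, TrivSqZeroExt.snd_add, TrivSqZeroExt.snd_inr, TrivSqZeroExt.snd_sum,
    TrivSqZeroExt.snd_mul, TrivSqZeroExt.snd_zero, smul_eq_mul, MulOpposite.smul_eq_mul_unop,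
    MulOpposite.unop_op, hsq, hadd, sum_const_zero, add_zero] at hsnd
  exact ⟨hsnd, hfst⟩

theorem inn_one_zero {α β : ℕ} (v : Amb α β) :
    inn v (1, 0) = TrivSqZeroExt.inr (∑ i, v.1 i) := by
  simp [inn]

theorem inn_zero_uu {α β : ℕ} (v : Amb α β) :
    inn v (0, fun _ => uu) = TrivSqZeroExt.inr (∑ j, (v.2 j).fst) := by
  ext <;> simp [inn, uu, TrivSqZeroExt.fst_sum, TrivSqZeroExt.snd_sum, -DualNumber.inr_eq_smul_eps]

theorem wtL_one_zero (α β : ℕ) : wtL ((1, 0) : Amb α β) = α := by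
  simp [wtL, wtH, wtLr]

theorem wtL_zero_uu (α β : ℕ) : wtL ((0, fun _ => uu) : Amb α β) = β * 2 := by
  simp [wtL, wtH, wtLr, uu_ne_zero]

-- STATEMENT 9
theorem stmt9 {α β : ℕ} (hα : 0 < α) (hβ : 0 < β) (C : Set (Amb α β)) (hC : IsSelfDual C)
    (hII : ∀ c ∈ C, 4 ∣ wtL c) :
    α % 4 = 0 ∧ β % 2 = 0 ∧ 4 ≤ α ∧ 2 ≤ β := by
  have hself : ∀ v ∈ C, ∑ i, v.1 i = 0 ∧ ∑ j, (v.2 j).fst = 0 := fun v hv => by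
    have hd : v ∈ dual C := hC.2 ▸ hv
    exact sum_eq_zero_of_inn_self (hd v hv)
  have hone : ((1, 0) : Amb α β) ∈ C := by
    rw [hC.2]
    intro v hv
    rw [inn_one_zero, (hself v hv).1, TrivSqZeroExt.inr_zero]
  have huu : ((0, fun _ => uu) : Amb α β) ∈ C := by
    rw [hC.2]
    intro v hv
    rw [inn_zero_uu, (hself v hv).2, TrivSqZeroExt.inr_zero]
  have h1 := hII _ hone
  have h2 := hII _ huu
  rw [wtL_one_zero] at h1
  rw [wtL_zero_uu] at h2
  omega

end Z2R
end

section
/- For every even natural number α and every natural number β there exists a self-dual Z_2R linear code in Z_2^α × R^β. -/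
open Finset

namespace Z2R

/-- The code of all words whose binary part repeats a word of length `k` twice and whose
`R`-part has all its entries in the ideal `(u)`. -/
def repetitionCode (k β : ℕ) : Set (Amb (k + k) β) :=
  {x | (∀ i : Fin k, x.1 (Fin.castAdd k i) = x.1 (Fin.natAdd k i)) ∧ ∀ j, (x.2 j).fst = 0}

theorem isCode_repetitionCode (k β : ℕ) : IsCode (repetitionCode k β) := by
  refine ⟨by simp [repetitionCode], ?_, ?_⟩
  · rintro x ⟨hx, hx'⟩ y ⟨hy, hy'⟩
    exact ⟨fun i => by simp [hx, hy], fun j => by simp [hx', hy']⟩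
  · rintro d x ⟨hx, hx'⟩
    exact ⟨fun i => by simp [smulR, hx], fun j => by simp [smulR, hx']⟩

theorem isSelfDual_repetitionCode (k β : ℕ) : IsSelfDual (repetitionCode k β) := by
  refine ⟨isCode_repetitionCode k β, Set.Subset.antisymm ?_ ?_⟩
  · rintro w ⟨hw, hw'⟩ v ⟨hv, hv'⟩
    have h₁ : ∑ i, v.1 i * w.1 i = 0 := by
      simp only [Fin.sum_univ_add, hv, hw]
      exact CharTwo.add_self_eq_zero _
    have h₂ : ∀ j, v.2 j * w.2 j = 0 := fun j => by
      ext <;> simp [hv', hw']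
    simp [inn, h₁, h₂]
  · intro w hw
    refine ⟨fun i => ?_, fun j => ?_⟩
    · have h := hw (Fin.append (Pi.single i 1) (Pi.single i 1), 0)
        ⟨fun l => by simp only [Fin.append_left, Fin.append_right], by simp⟩
      have hsnd := congrArg TrivSqZeroExt.snd h
      simp only [inn, Fin.sum_univ_add, Fin.append_left, Fin.append_right] at hsnd
      simp [Pi.single_apply, -Fin.natAdd_eq_addNat] at hsnd
      exact CharTwo.add_eq_zero.mp hsnd
    · have h := hw (0, Pi.single j uu) ⟨by simp, fun l => by
        by_cases hl : l = j
        · subst hl; simp [uu]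
        · simp [hl]⟩
      have hsnd := congrArg TrivSqZeroExt.snd h
      simpa [inn, Pi.single_apply, uu] using hsnd

-- STATEMENT 12
theorem stmt12 (α β : ℕ) (hα : Even α) :
    ∃ C : Set (Amb α β), IsSelfDual C := by
  obtain ⟨k, rfl⟩ := hα
  exact ⟨repetitionCode k β, isSelfDual_repetitionCode k β⟩

end Z2R
end

section
/- Let C ⊆ Z_2^α × R^β be a self-dual Z_2R linear code generated as an R-module by codewords (g_1 | r_1), …, (g_k | r_k) with g_i ∈ Z_2^α and r_i ∈ R^β. Let x ∈ Z_2^α have odd Hamming weight, and let y ∈ R^β have every coordinate in {0, u} and satisfy Σ_{j=1}^β r_{i,j} y_j = 0 in R for all 1 ≤ i ≤ k. Set h_i = Σ_{j=1}^α g_{i,j} x_j ∈ Z_2. Then the R-submodule D of Z_2^{α+2} × R^β generated by the vector (1, 0, x | y) together with the vectors (h_i, h_i, g_i | r_i), 1 ≤ i ≤ k, is a self-dual Z_2R linear code. Moreover, D is separable if and only if C is separable. -/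
open Finset

namespace Z2R

theorem inn_comm {α β : ℕ} (v w : Amb α β) : inn v w = inn w v := by
  simp only [inn, mul_comm]

theorem inn_add_left {α β : ℕ} (v v' w : Amb α β) : inn (v + v') w = inn v w + inn v' w := by
  simp only [inn, Prod.fst_add, Prod.snd_add, Pi.add_apply, add_mul, sum_add_distrib,
    TrivSqZeroExt.inr_add]
  abel

theorem inn_smulR_left {α β : ℕ} (d : Rng) (v w : Amb α β) :
    inn (smulR d v) w = d * inn v w := by
  simp only [inn, smulR, mul_add, mul_sum, mul_assoc]
  congr 1
  rw [← mul_sum]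
  ext <;> simp [mul_comm]

theorem inn_zero_left {α β : ℕ} (w : Amb α β) : inn 0 w = 0 := by
  simp [inn]

theorem inn_sum_left {α β k : ℕ} (v : Fin k → Amb α β) (w : Amb α β) :
    inn (∑ i, v i) w = ∑ i, inn (v i) w := by
  induction k with
  | zero => simp [inn_zero_left]
  | succ k ih => rw [Fin.sum_univ_succ, Fin.sum_univ_succ, inn_add_left, ih]

theorem smulR_zero {α β : ℕ} (d : Rng) : smulR d (0 : Amb α β) = 0 := by
  ext <;> simp [smulR]

theorem zero_smulR {α β : ℕ} (v : Amb α β) : smulR 0 v = 0 := by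
  ext <;> simp [smulR]

theorem one_smulR {α β : ℕ} (v : Amb α β) : smulR 1 v = v := by
  ext <;> simp [smulR]

theorem smulR_add {α β : ℕ} (d : Rng) (v w : Amb α β) :
    smulR d (v + w) = smulR d v + smulR d w := by
  simp only [smulR, Prod.fst_add, Prod.snd_add, Pi.add_apply, mul_add]
  rfl

theorem add_smulR {α β : ℕ} (d e : Rng) (v : Amb α β) :
    smulR (d + e) v = smulR d v + smulR e v := by
  simp only [smulR, TrivSqZeroExt.fst_add, add_mul]
  rfl

theorem mul_smulR {α β : ℕ} (d e : Rng) (v : Amb α β) :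
    smulR (d * e) v = smulR d (smulR e v) := by
  simp only [smulR, TrivSqZeroExt.fst_mul, mul_assoc]

theorem smulR_sum {α β k : ℕ} (d : Rng) (v : Fin k → Amb α β) :
    smulR d (∑ i, v i) = ∑ i, smulR d (v i) := by
  induction k with
  | zero => simp [smulR_zero]
  | succ k ih => rw [Fin.sum_univ_succ, Fin.sum_univ_succ, smulR_add, ih]

theorem add_self_amb {α β : ℕ} (v : Amb α β) : v + v = 0 := by
  ext <;> simp [CharTwo.add_self_eq_zero]

theorem isCode_lincomb {α β k : ℕ} (g : Fin k → Amb α β) : IsCode (lincomb g) := by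
  refine ⟨⟨0, by simp [zero_smulR]⟩, ?_, ?_⟩
  · rintro _ ⟨a, rfl⟩ _ ⟨b, rfl⟩
    exact ⟨a + b, by simp [add_smulR, sum_add_distrib]⟩
  · rintro d _ ⟨a, rfl⟩
    exact ⟨fun i => d * a i, by simp [mul_smulR, smulR_sum]⟩

theorem mem_lincomb {α β k : ℕ} (g : Fin k → Amb α β) (i : Fin k) : g i ∈ lincomb g := by
  refine ⟨Pi.single i 1, ?_⟩
  rw [sum_eq_single i (fun j _ hj => by rw [Pi.single_eq_of_ne hj, zero_smulR]) (by simp),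
    Pi.single_eq_same, one_smulR]

theorem mem_dual_lincomb {α β k : ℕ} (g : Fin k → Amb α β) (w : Amb α β) :
    w ∈ dual (lincomb g) ↔ ∀ i, inn (g i) w = 0 := by
  refine ⟨fun hw i => hw _ (mem_lincomb g i), ?_⟩
  rintro hw _ ⟨a, rfl⟩
  simp [inn_sum_left, inn_smulR_left, hw]

theorem lincomb_subset_dual {α β k : ℕ} (g : Fin k → Amb α β)
    (hg : ∀ i j, inn (g i) (g j) = 0) : lincomb g ⊆ dual (lincomb g) := by
  intro w hw
  rw [mem_dual_lincomb]
  intro i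
  rw [inn_comm]
  refine (mem_dual_lincomb g (g i)).2 (fun j => hg j i) w hw

theorem inn_zero_fst {α β : ℕ} (s : Fin β → Rng) (w : Amb α β) :
    inn (0, s) w = ∑ l, s l * w.2 l := by
  simp [inn]

theorem separable_lincomb_iff {α β k : ℕ} (g : Fin k → Amb α β)
    (hg : IsSelfDual (lincomb g)) :
    Separable (lincomb g) ↔ ∀ i j, ∑ l, (g i).2 l * (g j).2 l = 0 := by
  obtain ⟨⟨h0, hadd, -⟩, hdual⟩ := hg
  constructor
  · intro hs i j
    have hi : ((0, (g i).2) : Amb α β) ∈ lincomb g := by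
      rw [hs]
      exact ⟨⟨0, h0, rfl⟩, ⟨g i, mem_lincomb g i, rfl⟩⟩
    rw [hdual] at hi
    rw [← inn_zero_fst, inn_comm]
    exact hi _ (mem_lincomb g j)
  · intro ho
    have hgen : ∀ i, ((0, (g i).2) : Amb α β) ∈ dual (lincomb g) := fun i => by
      rw [mem_dual_lincomb]
      intro j
      rw [inn_comm, inn_zero_fst]
      exact ho i j
    have hmem : ∀ v ∈ lincomb g, ((0, v.2) : Amb α β) ∈ lincomb g := by
      intro v hv
      rw [hdual, mem_dual_lincomb]
      intro j
      have := hgen j v hv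
      rw [inn_comm, inn_zero_fst] at this ⊢
      simpa only [mul_comm] using this
    apply Set.Subset.antisymm
    · exact fun v hv => ⟨⟨v, hv, rfl⟩, ⟨v, hv, rfl⟩⟩
    · rintro ⟨a, b⟩ ⟨⟨v, hv, hva⟩, ⟨w, hw, hwb⟩⟩
      simp only at hva hwb
      subst hva hwb
      have hsum := hadd _ (hadd _ hv _ (hmem v hv)) _ (hmem w hw)
      convert hsum using 1
      have := congrArg Prod.snd (add_self_amb v)
      ext1
      · simp
      · simp only [Prod.snd_add, Prod.snd_zero] at this ⊢
        rw [this, zero_add]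

/-- Prepend two binary coordinates to a word. -/
def prepend {α β : ℕ} (a b : ZMod 2) (v : Amb α β) : Amb (2 + α) β :=
  (Fin.append ![a, b] v.1, v.2)

theorem exists_eq_prepend {α β : ℕ} (w : Amb (2 + α) β) :
    ∃ a b v, w = prepend a b v := by
  refine ⟨w.1 (Fin.castAdd α 0), w.1 (Fin.castAdd α 1), (fun i => w.1 (Fin.natAdd 2 i), w.2), ?_⟩
  refine Prod.ext (funext fun i => ?_) rfl
  refine Fin.addCases (fun i => ?_) (fun i => ?_) i
  · fin_cases i <;> simp [prepend]
  · simp [prepend]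

theorem prepend_add {α β : ℕ} (a b a' b' : ZMod 2) (v v' : Amb α β) :
    prepend a b v + prepend a' b' v' = prepend (a + a') (b + b') (v + v') := by
  refine Prod.ext (funext fun i => ?_) rfl
  refine Fin.addCases (fun i => ?_) (fun i => ?_) i
  · fin_cases i <;> simp [prepend]
  · simp [prepend]

theorem smulR_prepend {α β : ℕ} (d : Rng) (a b : ZMod 2) (v : Amb α β) :
    smulR d (prepend a b v) = prepend (d.fst * a) (d.fst * b) (smulR d v) := by
  refine Prod.ext (funext fun i => ?_) rfl
  refine Fin.addCases (fun i => ?_) (fun i => ?_) i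
  · fin_cases i <;> simp [prepend, smulR]
  · simp [prepend, smulR]

theorem prepend_zero {α β : ℕ} : prepend 0 0 (0 : Amb α β) = 0 := by
  refine Prod.ext (funext fun i => ?_) rfl
  refine Fin.addCases (fun i => ?_) (fun i => ?_) i
  · fin_cases i <;> simp [prepend]
  · simp [prepend]

theorem sum_prepend {α β k : ℕ} (a b : Fin k → ZMod 2) (v : Fin k → Amb α β) :
    ∑ i, prepend (a i) (b i) (v i) = prepend (∑ i, a i) (∑ i, b i) (∑ i, v i) := by
  induction k with
  | zero => simp [prepend_zero]
  | succ k ih => simp only [Fin.sum_univ_succ, ih, prepend_add]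

theorem inn_prepend {α β : ℕ} (a b c d : ZMod 2) (v w : Amb α β) :
    inn (prepend a b v) (prepend c d w) =
      TrivSqZeroExt.inr (a * c + b * d) + inn v w := by
  simp only [inn, prepend, Fin.sum_univ_add, Fin.append_left, Fin.append_right,
    Fin.sum_univ_two, TrivSqZeroExt.inr_add, Matrix.cons_val_zero, Matrix.cons_val_one]
  abel

theorem sum_mul_self_of_odd {n : ℕ} {x : Fin n → ZMod 2} (hx : Odd (wtH x)) :
    ∑ i, x i * x i = 1 := by
  have h : ∀ a : ZMod 2, a * a = if a ≠ 0 then 1 else 0 := by decide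
  simp only [h, sum_boole]
  exact (ZMod.natCast_eq_one_iff_odd).2 hx

theorem inn_eq_inr {α β : ℕ} (v w : Amb α β) (h : ∑ l, v.2 l * w.2 l = 0) :
    inn v w = TrivSqZeroExt.inr (∑ i, v.1 i * w.1 i) := by
  simp [inn, h]

-- STATEMENT 14
theorem stmt14 {α β k : ℕ} (g : Fin k → Fin α → ZMod 2) (r : Fin k → Fin β → Rng)
    (C : Set (Amb α β)) (hCgen : C = lincomb fun i => (g i, r i)) (hC : IsSelfDual C)
    (x : Fin α → ZMod 2) (hx : Odd (wtH x))
    (y : Fin β → Rng) (hy : ∀ j, y j = 0 ∨ y j = uu)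
    (hry : ∀ i, ∑ j, r i j * y j = 0)
    (h : Fin k → ZMod 2) (hh : ∀ i, h i = ∑ j, g i j * x j)
    (D : Set (Amb (2 + α) β))
    (hD : D = lincomb (Fin.cons (Fin.append ![(1 : ZMod 2), 0] x, y)
      fun i => (Fin.append ![h i, h i] (g i), r i))) :
    IsSelfDual D ∧ (Separable D ↔ Separable C) := by
  subst hCgen hD
  set c : Fin k → Amb α β := fun i => (g i, r i) with hc
  set p : Amb α β := (x, y) with hp
  set G : Fin (k + 1) → Amb (2 + α) β :=
    Fin.cons (prepend 1 0 p) (fun i => prepend (h i) (h i) (c i)) with hG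
  change IsSelfDual (lincomb G) ∧ (Separable (lincomb G) ↔ Separable (lincomb c))
  have hG0 : G 0 = prepend 1 0 p := rfl
  have hGs : ∀ i : Fin k, G i.succ = prepend (h i) (h i) (c i) := fun i => rfl
  have hcc : ∀ i j, inn (c i) (c j) = 0 := fun i j =>
    (hC.2.subset (mem_lincomb c j)) _ (mem_lincomb c i)
  have hyy : ∑ l, y l * y l = 0 := by
    refine sum_eq_zero fun l _ => ?_
    rcases hy l with e | e <;> simp [e, uu]
  have hpp : inn p p = TrivSqZeroExt.inr 1 := by
    rw [inn_eq_inr p p hyy, hp, sum_mul_self_of_odd hx]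
  have hcp : ∀ i, inn (c i) p = TrivSqZeroExt.inr (h i) := fun i => by
    rw [inn_eq_inr (c i) p (hry i), hh]
  have two : ∀ a : ZMod 2, a + a = 0 := CharTwo.add_self_eq_zero
  have horth : ∀ i j, inn (G i) (G j) = 0 := by
    intro i j
    refine Fin.cases ?_ (fun i => ?_) i <;> refine Fin.cases ?_ (fun j => ?_) j
    · rw [hG0, inn_prepend, hpp, ← TrivSqZeroExt.inr_add]
      simp [two]
    · rw [hG0, hGs, inn_prepend, inn_comm p, hcp, ← TrivSqZeroExt.inr_add]
      simp [two]
    · rw [hG0, hGs, inn_prepend, hcp, ← TrivSqZeroExt.inr_add]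
      simp [two]
    · rw [hGs, hGs, inn_prepend, hcc, two]
      simp
  have hself : IsSelfDual (lincomb G) := by
    refine ⟨isCode_lincomb G, (lincomb_subset_dual G horth).antisymm fun w hw => ?_⟩
    rw [mem_dual_lincomb] at hw
    obtain ⟨a, b, z, rfl⟩ := exists_eq_prepend w
    have hw0 := hw 0
    have hws := fun i : Fin k => hw i.succ
    simp only [hG0, hGs, inn_prepend] at hw0 hws
    set s : Rng := TrivSqZeroExt.inl (a + b) with hs
    have hmem : z + smulR s p ∈ lincomb c := by
      rw [hC.2, mem_dual_lincomb]
      intro i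
      have := hws i
      rw [inn_comm, inn_add_left, inn_smulR_left, inn_comm p, hcp, inn_comm z]
      rw [← this, add_comm]
      congr 1
      ext <;> simp [hs]
      ring
    obtain ⟨e, he⟩ := hmem
    have hb : ∑ i, (e i).fst * h i = b := by
      have key := congrArg (fun v => inn v p) he
      simp only [inn_add_left, inn_smulR_left, inn_sum_left, hpp, hcp] at key
      have k2 := congrArg TrivSqZeroExt.snd key
      have k3 := congrArg TrivSqZeroExt.snd hw0
      rw [inn_comm p] at k3
      simp [hs, TrivSqZeroExt.snd_sum] at k2 k3
      simp only [mul_comm (TrivSqZeroExt.fst _)]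
      rw [← k2]
      linear_combination k3
    refine ⟨Fin.cons s e, ?_⟩
    rw [Fin.sum_univ_succ]
    simp only [Fin.cons_zero, Fin.cons_succ, hG0, hGs, smulR_prepend, sum_prepend, prepend_add,
      ← he, hb]
    have hz : smulR s p + (z + smulR s p) = z := by
      rw [add_left_comm, add_self_amb, add_zero]
    rw [hz]
    congr 1
    · simp [hs, add_assoc, two]
    · simp
  refine ⟨hself, ?_⟩
  rw [separable_lincomb_iff G hself, separable_lincomb_iff c hC]
  constructor
  · exact fun H i j => H i.succ j.succ
  · intro H i j
    refine Fin.cases ?_ (fun i => ?_) i <;> refine Fin.cases ?_ (fun j => ?_) j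
    · exact hyy
    · exact (sum_congr rfl fun l _ => mul_comm _ _).trans (hry j)
    · exact hry i
    · exact H i j

end Z2R
end

section
/- Let C ⊆ Z_2^α × R^β be a self-dual Z_2R linear code generated as an R-module by codewords (g_1 | r_1), …, (g_k | r_k) with g_i ∈ Z_2^α and r_i ∈ R^β. Let y ∈ R^β have odd Lee weight wt_L(y), and let x ∈ Z_2^α have even Hamming weight and satisfy Σ_{j=1}^α g_{i,j} x_j = 0 in Z_2 for all 1 ≤ i ≤ k. Let t ∈ {1, 1+u} be a unit of R and set s_i = Σ_{j=1}^β r_{i,j} y_j ∈ R. Then the R-submodule E of Z_2^α × R^{β+2} generated by the vector (x | 1, 0, y) together with the vectors (g_i | s_i, t·s_i, r_i), 1 ≤ i ≤ k, is a self-dual Z_2R linear code. Moreover, E is separable if and only if C is separable. -/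
open Finset

namespace Z2R

theorem two_eq_zero_rng : (2 : Rng) = 0 := by
  have h : (2 : Rng) = TrivSqZeroExt.inl 2 := rfl
  rw [h, show (2 : ZMod 2) = 0 from rfl, TrivSqZeroExt.inl_zero]

theorem mul_self_eq_wtLr (a : Rng) : a * a = (wtLr a : Rng) := by
  have e0 : (a = 0) ↔ a.fst = 0 ∧ a.snd = 0 := by simp [TrivSqZeroExt.ext_iff]
  have e1 : (a = uu) ↔ a.fst = 0 ∧ a.snd = 1 := by
    rw [TrivSqZeroExt.ext_iff]; rfl
  have h0 : ∀ c : ZMod 2, c = 0 ∨ c = 1 := by decide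
  have h2 : (1 : ZMod 2) + 1 = 0 := by decide
  unfold wtLr
  rw [if_congr e0 rfl (if_congr e1 rfl rfl)]
  apply TrivSqZeroExt.ext <;>
    rcases h0 a.fst with h | h <;> rcases h0 a.snd with h' | h' <;>
    simp [h, h', h2, two_eq_zero_rng]

theorem sum_mul_self_eq_one {β : ℕ} {y : Fin β → Rng} (hy : Odd (∑ j, wtLr (y j))) :
    ∑ j, y j * y j = 1 := by
  obtain ⟨m, hm⟩ := hy
  simp_rw [mul_self_eq_wtLr]
  rw [← Nat.cast_sum, hm]
  push_cast
  rw [two_eq_zero_rng]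
  ring

/-- The extended word `(a | P, Q, B)`. -/
def extWord {α β : ℕ} (a : Fin α → ZMod 2) (P Q : Rng) (B : Fin β → Rng) : Amb α (2 + β) :=
  (a, Fin.append ![P, Q] B)

section extWord

variable {α β : ℕ}

theorem exists_eq_extWord (z : Amb α (2 + β)) : ∃ a P Q B, z = extWord a P Q B := by
  refine ⟨z.1, z.2 (Fin.castAdd β 0), z.2 (Fin.castAdd β 1), fun j => z.2 (Fin.natAdd 2 j), ?_⟩
  refine Prod.ext rfl (funext fun j => ?_)
  refine Fin.addCases (fun i => ?_) (fun i => ?_) j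
  · fin_cases i <;> simp [extWord, -Fin.castAdd_zero]
  · simp [extWord]

theorem extWord_inj {a a' : Fin α → ZMod 2} {P P' Q Q' : Rng} {B B' : Fin β → Rng} :
    extWord a P Q B = extWord a' P' Q' B' ↔ a = a' ∧ P = P' ∧ Q = Q' ∧ B = B' := by
  refine ⟨fun h => ?_, by rintro ⟨rfl, rfl, rfl, rfl⟩; rfl⟩
  have h2 := congrArg Prod.snd h
  refine ⟨congrArg Prod.fst h, ?_, ?_, funext fun j => ?_⟩
  · simpa only [extWord, Fin.append_left, Matrix.cons_val_zero] using
      congrFun h2 (Fin.castAdd β 0)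
  · simpa only [extWord, Fin.append_left, Matrix.cons_val_one,
      Matrix.cons_val_zero] using
      congrFun h2 (Fin.castAdd β 1)
  · simpa only [extWord, Fin.append_right] using congrFun h2 (Fin.natAdd 2 j)

theorem extWord_zero : extWord (0 : Fin α → ZMod 2) 0 0 (0 : Fin β → Rng) = 0 := by
  refine Prod.ext rfl (funext fun j => ?_)
  refine Fin.addCases (fun i => ?_) (fun i => ?_) j
  · fin_cases i <;> simp only [extWord, Fin.append_left] <;> rfl
  · simp [extWord]

theorem extWord_add (a a' : Fin α → ZMod 2) (P P' Q Q' : Rng) (B B' : Fin β → Rng) :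
    extWord a P Q B + extWord a' P' Q' B' = extWord (a + a') (P + P') (Q + Q') (B + B') := by
  refine Prod.ext rfl (funext fun j => ?_)
  refine Fin.addCases (fun i => ?_) (fun i => ?_) j
  · fin_cases i <;>
      simp only [extWord, Prod.mk_add_mk, Pi.add_apply, Fin.append_left] <;> rfl
  · simp [extWord]

theorem smulR_extWord (d : Rng) (a : Fin α → ZMod 2) (P Q : Rng) (B : Fin β → Rng) :
    smulR d (extWord a P Q B) =
      extWord (fun i => d.fst * a i) (d * P) (d * Q) (fun j => d * B j) := by
  refine Prod.ext rfl (funext fun j => ?_)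
  refine Fin.addCases (fun i => ?_) (fun i => ?_) j
  · fin_cases i <;> simp only [extWord, smulR, Fin.append_left] <;> rfl
  · simp [extWord, smulR]

theorem sum_extWord {ι : Type*} (S : Finset ι) (a : ι → Fin α → ZMod 2) (P Q : ι → Rng)
    (B : ι → Fin β → Rng) :
    ∑ i ∈ S, extWord (a i) (P i) (Q i) (B i) =
      extWord (∑ i ∈ S, a i) (∑ i ∈ S, P i) (∑ i ∈ S, Q i) (∑ i ∈ S, B i) := by
  classical
  induction S using Finset.induction_on with
  | empty => simp [extWord_zero]
  | insert i S hi ih => simp only [Finset.sum_insert hi, ih, extWord_add]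

theorem inn_extWord (a a' : Fin α → ZMod 2) (P P' Q Q' : Rng) (B B' : Fin β → Rng) :
    inn (extWord a P Q B) (extWord a' P' Q' B') =
      inn (a, B) (a', B') + P * P' + Q * Q' := by
  simp only [inn, extWord, Fin.sum_univ_add, Fin.append_left, Fin.append_right,
    Fin.sum_univ_two, Matrix.cons_val_zero, Matrix.cons_val_one]
  ring

/-- The words `(a | p + b·y, t(b·y), b + py)` with `(a | b) ∈ C` and `p ∈ R`. -/
def extCode (C : Set (Amb α β)) (y : Fin β → Rng) (t : Rng) : Set (Amb α (2 + β)) :=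
  {z | ∃ a b p, (a, b) ∈ C ∧
    z = extWord a (p + b ⬝ᵥ y) (t * (b ⬝ᵥ y)) (b + p • y)}

variable {C : Set (Amb α β)} {y : Fin β → Rng} {t : Rng}

theorem isCode_extCode (hC : IsCode C) : IsCode (extCode C y t) := by
  obtain ⟨h0, hadd, hsmul⟩ := hC
  refine ⟨⟨0, 0, 0, h0, by simp [extWord_zero]⟩, ?_, ?_⟩
  · rintro _ ⟨a, b, p, h, rfl⟩ _ ⟨a', b', p', h', rfl⟩
    refine ⟨a + a', b + b', p + p', hadd _ h _ h', ?_⟩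
    rw [extWord_add, extWord_inj]
    refine ⟨rfl, ?_, ?_, ?_⟩
    · rw [add_dotProduct]; ring
    · rw [add_dotProduct]; ring
    · rw [add_smul]; abel
  · rintro d _ ⟨a, b, p, h, rfl⟩
    refine ⟨_, d • b, d * p, hsmul d _ h, ?_⟩
    rw [smulR_extWord, extWord_inj]
    refine ⟨rfl, ?_, ?_, ?_⟩
    · rw [smul_dotProduct, smul_eq_mul]; ring
    · rw [smul_dotProduct, smul_eq_mul]; ring
    · ext1 j
      simp only [Pi.add_apply, Pi.smul_apply, smul_eq_mul]; ring

theorem inn_eq (a a' : Fin α → ZMod 2) (b b' : Fin β → Rng) :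
    inn (a, b) (a', b') = TrivSqZeroExt.inr (a ⬝ᵥ a') + b ⬝ᵥ b' := rfl

theorem isSelfDual_extCode (hC : IsSelfDual C) (hy : y ⬝ᵥ y = 1) (ht : t * t = 1) :
    IsSelfDual (extCode C y t) := by
  obtain ⟨hcode, hdual⟩ := hC
  have h2 := two_eq_zero_rng
  refine ⟨isCode_extCode hcode, Set.Subset.antisymm ?_ ?_⟩
  · rintro _ ⟨a, b, p, h, rfl⟩ _ ⟨a', b', p', h', rfl⟩
    have h0 : inn (a', b') (a, b) = 0 := by
      rw [hdual] at h
      exact h _ h'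
    rw [inn_extWord]
    rw [inn_eq] at h0 ⊢
    simp only [add_dotProduct, dotProduct_add, smul_dotProduct, dotProduct_smul, smul_eq_mul, hy]
    rw [dotProduct_comm y b]
    linear_combination h0 + (b' ⬝ᵥ y) * (b ⬝ᵥ y) * ht +
      (p * (b' ⬝ᵥ y) + p' * (b ⬝ᵥ y) + p * p' + (b' ⬝ᵥ y) * (b ⬝ᵥ y)) * h2
  · intro w hw
    obtain ⟨a, P, Q, B, rfl⟩ := exists_eq_extWord w
    have hP : P + B ⬝ᵥ y = 0 := by
      have := hw _ ⟨0, 0, 1, hcode.1, rfl⟩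
      rw [inn_extWord, inn_eq] at this
      simp only [zero_dotProduct, TrivSqZeroExt.inr_zero, one_smul, zero_add] at this
      rw [dotProduct_comm]
      linear_combination this
    have hmem : (a, B + (P + t * Q) • y) ∈ C := by
      rw [hdual]
      rintro ⟨a', b'⟩ h'
      have := hw _ ⟨a', b', 0, h', rfl⟩
      rw [inn_extWord, inn_eq] at this
      rw [inn_eq]
      simp only [zero_smul, add_zero, zero_add, dotProduct_add, dotProduct_smul,
        smul_eq_mul] at this ⊢
      linear_combination this
    have hby : (B + (P + t * Q) • y) ⬝ᵥ y = t * Q := by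
      rw [add_dotProduct, smul_dotProduct, hy, smul_eq_mul]
      linear_combination hP
    refine ⟨a, _, P + t * Q, hmem, ?_⟩
    rw [extWord_inj, hby]
    refine ⟨rfl, ?_, ?_, ?_⟩
    · linear_combination (-t * Q) * h2
    · linear_combination -Q * ht
    · ext1 j
      simp only [Pi.add_apply, Pi.smul_apply, smul_eq_mul]
      linear_combination (-(P + t * Q) * y j) * h2

theorem separable_iff : Separable C ↔
    ∀ a b a' b', (a, b) ∈ C → (a', b') ∈ C → (a, b') ∈ C := by
  constructor
  · intro h a b a' b' h1 h2
    rw [h]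
    exact ⟨⟨_, h1, rfl⟩, ⟨_, h2, rfl⟩⟩
  · intro h
    refine Set.Subset.antisymm (fun z hz => ⟨⟨z, hz, rfl⟩, ⟨z, hz, rfl⟩⟩) ?_
    rintro ⟨_, _⟩ ⟨⟨⟨a, b⟩, h1, rfl⟩, ⟨⟨a', b'⟩, h2, rfl⟩⟩
    exact h _ _ _ _ h1 h2

theorem separable_extCode_iff (ht : t * t = 1) : Separable (extCode C y t) ↔ Separable C := by
  rw [separable_iff, separable_iff]
  constructor
  · intro h a b a' b' h1 h2
    obtain ⟨a₁, b₁, p, hm, he⟩ :=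
      h a _ a' _ ⟨a, b, 0, h1, rfl⟩ ⟨a', b', 0, h2, rfl⟩
    obtain ⟨rfl, hP, hQ, hB⟩ := extWord_inj.1 he
    have hd : b' ⬝ᵥ y = b₁ ⬝ᵥ y := by
      linear_combination t * hQ + (b₁ ⬝ᵥ y - b' ⬝ᵥ y) * ht
    have hp : p = 0 := by linear_combination hd - hP
    have hb : b' = b₁ := by simpa [hp] using hB
    rwa [hb]
  · rintro h a _ a' _ ⟨a₁, b, p, h1, he⟩ ⟨a₂, b', p', h2, he'⟩
    obtain rfl : a = a₁ := congrArg Prod.fst he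
    obtain rfl : _ = Fin.append _ _ := congrArg Prod.snd he'
    exact ⟨a, b', p', h _ _ _ _ h1 h2, rfl⟩

theorem lincomb_eq_extCode {k : ℕ} {g : Fin k → Fin α → ZMod 2} {r : Fin k → Fin β → Rng}
    (hC : IsCode (lincomb fun i => (g i, r i))) {x : Fin α → ZMod 2}
    (hx : (x, 0) ∈ lincomb fun i => (g i, r i)) :
    lincomb (Fin.cons (extWord x 1 0 y)
      fun i => extWord (g i) (r i ⬝ᵥ y) (t * (r i ⬝ᵥ y)) (r i)) =
      extCode (lincomb fun i => (g i, r i)) y t := by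
  have key : ∀ (d : Rng) (c : Fin k → Rng),
      (∑ i, smulR ((Fin.cons d c : Fin (k + 1) → Rng) i)
        ((Fin.cons (extWord x 1 0 y)
          fun i => extWord (g i) (r i ⬝ᵥ y) (t * (r i ⬝ᵥ y)) (r i) :
            Fin (k + 1) → Amb α (2 + β)) i)) =
      extWord (d.fst • x + ∑ i, (c i).fst • g i) (d + (∑ i, c i • r i) ⬝ᵥ y)
        (t * ((∑ i, c i • r i) ⬝ᵥ y)) ((∑ i, c i • r i) + d • y) := by
    intro d c
    simp only [Fin.sum_univ_succ, Fin.cons_zero, Fin.cons_succ, smulR_extWord, sum_extWord,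
      extWord_add, extWord_inj, sum_dotProduct, smul_dotProduct, Finset.mul_sum]
    refine ⟨rfl, ?_, ?_, ?_⟩
    · simp
    · simp [mul_left_comm]
    · exact add_comm _ _
  have key' : ∀ c : Fin k → Rng, ∑ i, smulR (c i) (g i, r i) =
      (∑ i, (c i).fst • g i, ∑ i, c i • r i) := by
    intro c
    rw [Prod.ext_iff, Prod.fst_sum, Prod.snd_sum]
    exact ⟨rfl, rfl⟩
  ext z
  constructor
  · rintro ⟨c, rfl⟩
    rw [← Fin.cons_self_tail c, key]
    refine ⟨_, _, _, ?_, rfl⟩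
    have := hC.2.1 _ (hC.2.2 (c 0) _ hx) _ ⟨Fin.tail c, rfl⟩
    rw [key'] at this
    convert this using 1
    ext j <;> simp [smulR]
  · rintro ⟨a, b, p, h, rfl⟩
    obtain ⟨c, hc⟩ := hC.2.1 _ (hC.2.2 p _ hx) _ h
    obtain ⟨hc₁, hc₂⟩ := Prod.ext_iff.1 (hc.trans (key' c))
    dsimp only at hc₁ hc₂
    have hb : b = ∑ i, c i • r i := by
      rw [← hc₂]; ext1 j; simp [smulR]
    have ha : a = p.fst • x + ∑ i, (c i).fst • g i := by
      rw [← hc₁]; ext1 j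
      simp only [smulR, Prod.mk_add_mk, Pi.add_apply, Pi.smul_apply, smul_eq_mul]
      rw [← add_assoc, CharTwo.add_self_eq_zero, zero_add]
    refine ⟨Fin.cons p c, ?_⟩
    rw [key, ha, hb]

end extWord

-- STATEMENT 15
theorem stmt15 {α β k : ℕ} (g : Fin k → Fin α → ZMod 2) (r : Fin k → Fin β → Rng)
    (C : Set (Amb α β)) (hCgen : C = lincomb fun i => (g i, r i)) (hC : IsSelfDual C)
    (y : Fin β → Rng) (hy : Odd (∑ j, wtLr (y j)))
    (x : Fin α → ZMod 2) (hx : Even (wtH x)) (hgx : ∀ i, ∑ j, g i j * x j = 0)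
    (t : Rng) (ht : t = 1 ∨ t = 1 + uu)
    (s : Fin k → Rng) (hs : ∀ i, s i = ∑ j, r i j * y j)
    (E : Set (Amb α (2 + β)))
    (hE : E = lincomb (Fin.cons (x, Fin.append ![(1 : Rng), 0] y)
      fun i => (g i, Fin.append ![s i, t * s i] (r i)))) :
    IsSelfDual E ∧ (Separable E ↔ Separable C) := by
  have ht' : t * t = 1 := by
    have hu : uu * uu = 0 := DualNumber.eps_mul_eps
    rcases ht with rfl | rfl
    · ring
    · linear_combination uu * two_eq_zero_rng + hu
  have hx' : (x, 0) ∈ C := by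
    rw [hC.2]
    intro v hv
    rw [hCgen] at hv
    obtain ⟨c, rfl⟩ := hv
    have hz : (∑ i, (c i).fst • g i) ⬝ᵥ x = 0 := by
      rw [sum_dotProduct]
      exact Finset.sum_eq_zero fun i _ => by
        rw [smul_dotProduct, show g i ⬝ᵥ x = 0 from hgx i, smul_zero]
    have hfst : (∑ i, smulR (c i) (g i, r i)).1 = ∑ i, (c i).fst • g i := by
      rw [Prod.fst_sum]; rfl
    rw [← Prod.mk.eta (p := ∑ i, smulR (c i) (g i, r i)), hfst, inn_eq, hz, dotProduct_zero,
      TrivSqZeroExt.inr_zero, add_zero]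
  obtain rfl : s = fun i => r i ⬝ᵥ y := funext hs
  have hEC : E = extCode C y t := by
    subst hCgen
    exact hE.trans (lincomb_eq_extCode hC.1 hx')
  rw [hEC]
  exact ⟨isSelfDual_extCode hC (sum_mul_self_eq_one hy) ht', separable_extCode_iff ht'⟩

end Z2R
end

section
/- Let C ⊆ Z_2^α × R^β be a Z_2R linear code with α > 0 and β > 0 such that (1,…,1 | 0,…,0) ∈ C and (0,…,0 | u,…,u) ∈ C, and such that the set of Lee weights of nonzero codewords of C has exactly two elements. Then α = 2β and, with n = α + 2β: the zero codeword is the unique codeword of Lee weight 0, exactly one codeword of C has Lee weight n (namely (1,…,1 | u,…,u)), and the remaining |C| − 2 codewords all have Lee weight n/2. -/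
open Finset

namespace Z2R

theorem wtLr_zero : wtLr 0 = 0 := by simp [wtLr]

theorem wtLr_uu : wtLr uu = 2 := by simp [wtLr, uu_ne_zero]

theorem wtLr_le_two (r : Rng) : wtLr r ≤ 2 := by
  unfold wtLr
  split_ifs <;> omega

theorem wtLr_eq_zero {r : Rng} (h : wtLr r = 0) : r = 0 := by
  unfold wtLr at h
  split_ifs at h
  assumption

theorem wtLr_eq_two {r : Rng} (h : wtLr r = 2) : r = uu := by
  unfold wtLr at h
  split_ifs at h
  · assumption
  · omega

theorem wtH_le {n : ℕ} (v : Fin n → ZMod 2) : wtH v ≤ n := by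
  simpa [wtH] using card_filter_le (univ : Finset (Fin n)) fun i => v i ≠ 0

theorem wtH_eq_zero {n : ℕ} {v : Fin n → ZMod 2} (h : wtH v = 0) : v = 0 := by
  funext i
  simpa using filter_eq_empty_iff.mp (card_eq_zero.mp h) (mem_univ i)

theorem wtH_eq_length {n : ℕ} {v : Fin n → ZMod 2} (h : wtH v = n) : v = fun _ => 1 := by
  funext i
  have hv := (card_filter_eq_iff (s := (univ : Finset (Fin n))) (p := fun i => v i ≠ 0)).mp
    (by simpa [wtH] using h) i (mem_univ i)
  exact Fin.eq_one_of_ne_zero (v i) hv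

theorem sum_wtLr_le {β : ℕ} (w : Fin β → Rng) : ∑ j, wtLr (w j) ≤ 2 * β := by
  calc ∑ j, wtLr (w j) ≤ ∑ _j : Fin β, 2 := sum_le_sum fun j _ => wtLr_le_two (w j)
    _ = 2 * β := by simp [mul_comm]

theorem eq_uu_of_sum_wtLr_eq {β : ℕ} {w : Fin β → Rng} (h : ∑ j, wtLr (w j) = 2 * β) :
    w = fun _ => uu := by
  funext j
  refine wtLr_eq_two ((sum_eq_sum_iff_of_le (g := fun _ => 2)
    fun j _ => wtLr_le_two (w j)).mp ?_ j (mem_univ j))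
  simp [h, mul_comm]

theorem wtL_zero {α β : ℕ} : wtL (0 : Amb α β) = 0 := by simp [wtL, wtH, wtLr_zero]

theorem wtL_eq_zero {α β : ℕ} {c : Amb α β} (h : wtL c = 0) : c = 0 := by
  obtain ⟨hH, hL⟩ := Nat.add_eq_zero_iff.mp h
  refine Prod.ext (wtH_eq_zero hH) (funext fun j => wtLr_eq_zero ?_)
  exact sum_eq_zero_iff.mp hL j (mem_univ j)

theorem wtL_one_uu {α β : ℕ} :
    wtL ((fun _ => 1, fun _ => uu) : Amb α β) = α + 2 * β := by
  simp [wtL, wtH, wtLr_uu, mul_comm]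

theorem eq_one_uu_of_wtL_eq {α β : ℕ} {c : Amb α β} (h : wtL c = α + 2 * β) :
    c = (fun _ => 1, fun _ => uu) := by
  have hH := wtH_le c.1
  have hL := sum_wtLr_le c.2
  unfold wtL at h
  exact Prod.ext (wtH_eq_length (by omega)) (eq_uu_of_sum_wtLr_eq (by omega))

-- STATEMENT 16
theorem stmt16 {α β : ℕ} (hα : 0 < α) (hβ : 0 < β) (C : Set (Amb α β)) (hcode : IsCode C)
    (h1 : ((fun _ => 1, fun _ => 0) : Amb α β) ∈ C)
    (h2 : ((fun _ => 0, fun _ => uu) : Amb α β) ∈ C)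
    (htw : (wtL '' (C \ {0})).ncard = 2) :
    α = 2 * β ∧
      {c ∈ C | wtL c = 0} = {0} ∧
      {c ∈ C | wtL c = α + 2 * β} = {((fun _ => 1, fun _ => uu) : Amb α β)} ∧
      ∀ c ∈ C, c ≠ 0 → c ≠ ((fun _ => 1, fun _ => uu) : Amb α β) →
        2 * wtL c = α + 2 * β := by
  have h3 : ((fun _ => 1, fun _ => uu) : Amb α β) ∈ C := by
    convert hcode.2.1 _ h1 _ h2 using 1
    ext <;> simp
  have hmem : ∀ c ∈ C, wtL c ≠ 0 → wtL c ∈ wtL '' (C \ {0}) := fun c hc h =>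
    ⟨c, ⟨hc, fun h0 => h (by rw [Set.mem_singleton_iff.mp h0, wtL_zero])⟩, rfl⟩
  have w1 : wtL ((fun _ => 1, fun _ => 0) : Amb α β) = α := by simp [wtL, wtH, wtLr_zero]
  have w2 : wtL ((fun _ => 0, fun _ => uu) : Amb α β) = 2 * β := by
    simp [wtL, wtH, wtLr_uu, mul_comm]
  have m1 := hmem _ h1 (by omega)
  have m2 := hmem _ h2 (by omega)
  have m3 := hmem _ h3 (by rw [wtL_one_uu]; omega)
  rw [w1] at m1
  rw [w2] at m2
  rw [wtL_one_uu] at m3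
  have hS : ({α, α + 2 * β} : Set ℕ) = wtL '' (C \ {0}) := by
    refine Set.eq_of_subset_of_ncard_le (Set.pair_subset m1 m3) ?_
      (Set.finite_of_ncard_ne_zero (by omega))
    rw [htw, Set.ncard_pair (by omega)]
  have hαβ : α = 2 * β := by
    rw [← hS] at m2
    rcases m2 with h | h
    · exact h.symm
    · have := Set.mem_singleton_iff.mp h
      omega
  refine ⟨hαβ, ?_, ?_, ?_⟩
  · ext c
    refine ⟨fun h => wtL_eq_zero h.2, ?_⟩
    rintro rfl
    exact ⟨hcode.1, wtL_zero⟩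
  · ext c
    refine ⟨fun h => eq_one_uu_of_wtL_eq h.2, ?_⟩
    rintro rfl
    exact ⟨h3, wtL_one_uu⟩
  · intro c hc h0 hne
    have m := hmem c hc fun h => h0 (wtL_eq_zero h)
    rw [← hS] at m
    rcases m with h | h
    · omega
    · exact absurd (eq_one_uu_of_wtL_eq h) hne

end Z2R
end
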